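/- Under the same data and feasibility hypotheses as in the data-driven invariance theorem (data ẋʲ = A★zʲ + B★vʲ + dʲ with ‖dʲ‖² ≤ ω; τⱼ ≥ 0, A_i ≻ 0, B_i satisfying the LMI [[−I − Σⱼ τⱼcⱼ, B_iᵀ − Σⱼ τⱼbⱼᵀ, B_iᵀ], [B_i − Σⱼ τⱼbⱼ, A_i − Σⱼ τⱼaⱼ, 0], [B_i, 0, −A_i]] ⪯ 0; ζ̄ := −A_i⁻¹B_i, P̄ := A_i^{−1/2}), assume in addition: given polynomials σ₁,…,σ_q and λ in n variables, a scalar η̄ > 0, and a scalar θ ≥ 0, there exist polynomials ℓ, η, h, a vector K of m polynomials, and polynomials s₁,…,s_q, ς in n variables such that: (a) η − η̄ is a sum of squares of polynomials; (b) −H is a sum-of-squares matrix polynomial, i.e., there exist finitely many matrix polynomials H₁,…,H_k with −H = Σᵢ HᵢᵀHᵢ, where H(x) := [[ℓ(x)h(x) + ε + ∇h(x)·(ζ̄ᵀw(x)), η(x)(P̄w(x))ᵀ, ∇h(x)ᵀ], [η(x)P̄w(x), −2η(x)I, 0], [∇h(x), 0, −2η(x)I]] and w(x) := (Z(x), W(x)K(x));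 (c) s₁,…,s_q, ς are each sums of squares of polynomials; (d) ς·(λ − θ) − h is a sum of squares of polynomials; (e) sⱼ·h − σⱼ is a sum of squares of polynomials for each j = 1,…,q. Then the set I := {x ∈ ℝⁿ : h(x) ≤ 0} is invariant for ẋ = A★Z(x) + B★W(x)K(x) (every solution starting with h(x(0)) ≤ 0 satisfies h(x(t)) ≤ 0 on its interval of existence) and satisfies {x : λ(x) ≤ θ} ⊆ I ⊆ {x : σⱼ(x) ≤ 0 for all j = 1,…,q}. -/

import Mathlib

open Matrix MvPolynomial
open scoped ENNReal

/-- The gradient of a multivariate polynomial, as a vector of evaluated partial derivatives. -/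
noncomputable def gradPoly {n : ℕ} (h : MvPolynomial (Fin n) ℝ) (x : Fin n → ℝ) : Fin n → ℝ :=
  fun i => eval x (pderiv i h)

/-- A polynomial is a sum of squares if it is a finite sum of squares of polynomials. -/
def IsSOS {n : ℕ} (p : MvPolynomial (Fin n) ℝ) : Prop :=
  ∃ (k : ℕ) (q : Fin k → MvPolynomial (Fin n) ℝ), p = ∑ i, q i ^ 2

theorem IsSOS.eval_nonneg {n : ℕ} {p : MvPolynomial (Fin n) ℝ} (hp : IsSOS p) (x : Fin n → ℝ) :
    0 ≤ eval x p := by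
  obtain ⟨k, q, rfl⟩ := hp
  simp only [map_sum, map_pow]
  positivity

/-- The chain rule for a polynomial along a differentiable curve. -/
theorem hasDerivWithinAt_eval_comp {n : ℕ} (p : MvPolynomial (Fin n) ℝ) {x : ℝ → Fin n → ℝ}
    {x' : Fin n → ℝ} {S : Set ℝ} {t : ℝ} (hx : HasDerivWithinAt x x' S t) :
    HasDerivWithinAt (fun r => eval (x r) p) (gradPoly p (x t) ⬝ᵥ x') S t := by
  induction p using MvPolynomial.induction_on with
  | C r => simpa [gradPoly, dotProduct] using hasDerivWithinAt_const t S r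
  | add p q hp hq =>
    have hgrad : gradPoly (p + q) (x t) = gradPoly p (x t) + gradPoly q (x t) := by
      funext i
      simp [gradPoly]
    simp only [map_add, hgrad, add_dotProduct]
    exact hp.add hq
  | mul_X p i hp =>
    have hgrad : gradPoly (p * X i) (x t) =
        x t i • gradPoly p (x t) + eval (x t) p • Pi.single i 1 := by
      funext j
      rcases eq_or_ne i j with rfl | hij
      · simp [gradPoly, add_comm]
      · simp [gradPoly, pderiv_X, hij, hij.symm]
    simp only [map_mul, eval_X, hgrad, add_dotProduct, smul_dotProduct, single_one_dotProduct,
      smul_eq_mul, mul_comm (x t i)]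
    exact hp.mul (hasDerivWithinAt_pi.1 hx i)

theorem dotProduct_sq_le {ι : Type*} [Fintype ι] (u v : ι → ℝ) :
    (u ⬝ᵥ v) ^ 2 ≤ (u ⬝ᵥ u) * (v ⬝ᵥ v) := by
  simpa [dotProduct, sq] using Finset.sum_mul_sq_le_sq_mul_sq Finset.univ u v

theorem two_mul_dotProduct_le {ι : Type*} [Fintype ι] {η : ℝ} (hη : 0 < η) (u v : ι → ℝ) :
    2 * (u ⬝ᵥ v) ≤ η * (u ⬝ᵥ u) + η⁻¹ * (v ⬝ᵥ v) := by
  simp only [dotProduct, Finset.mul_sum, ← Finset.sum_add_distrib]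
  refine Finset.sum_le_sum fun i _ => ?_
  have h : η * (u i * u i) + η⁻¹ * (v i * v i) - 2 * (u i * v i) = η * (u i - η⁻¹ * v i) ^ 2 := by
    field_simp
    ring
  have : 0 ≤ η * (u i - η⁻¹ * v i) ^ 2 := by positivity
  linarith

/-- The quadratic form of a block matrix of the shape appearing in the data-based LMI. -/
theorem dotProduct_arrow_mulVec {ι κ μ : Type*} [Fintype ι] [Fintype κ] [Fintype μ]
    (M : Matrix ι ι ℝ) (N : Matrix κ ι ℝ) (O : Matrix μ ι ℝ) (Q : Matrix κ κ ℝ) (R : Matrix μ μ ℝ)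
    (u : ι → ℝ) (y : κ → ℝ) (v : μ → ℝ) :
    Sum.elim u (Sum.elim y v) ⬝ᵥ
      (fromBlocks M (fromCols Nᵀ Oᵀ) (fromRows N O) (fromBlocks Q 0 0 R)) *ᵥ
        Sum.elim u (Sum.elim y v) =
      u ⬝ᵥ M *ᵥ u + 2 * (y ⬝ᵥ N *ᵥ u) + 2 * (v ⬝ᵥ O *ᵥ u) + y ⬝ᵥ Q *ᵥ y + v ⬝ᵥ R *ᵥ v := by
  have hN : u ⬝ᵥ Nᵀ *ᵥ y = y ⬝ᵥ N *ᵥ u := by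
    rw [mulVec_transpose, dotProduct_comm, dotProduct_mulVec]
  have hO : u ⬝ᵥ Oᵀ *ᵥ v = v ⬝ᵥ O *ᵥ u := by
    rw [mulVec_transpose, dotProduct_comm, dotProduct_mulVec]
  simp only [fromBlocks_mulVec, Sum.elim_comp_inl, Sum.elim_comp_inr, fromCols_mulVec_sumElim,
    fromRows_mulVec, zero_mulVec, add_zero, zero_add, dotProduct_add,
    sumElim_dotProduct_sumElim, hN, hO]
  ring

/-- Every system consistent with the data lies in the matrix ellipsoid given by the LMI. -/
theorem ellipsoid_of_LMI {ι κ J : Type*} [Fintype ι] [Fintype κ] [DecidableEq ι] [DecidableEq κ]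
    [Fintype J] {ω : ℝ} (ζ : Matrix κ ι ℝ) (xdot : J → ι → ℝ) (g : J → κ → ℝ)
    (hdata : ∀ j, ∃ d : ι → ℝ, xdot j = ζᵀ *ᵥ g j + d ∧ d ⬝ᵥ d ≤ ω)
    {c : J → Matrix ι ι ℝ} (hc : ∀ j, c j = -(ω • 1) + vecMulVec (xdot j) (xdot j))
    {b : J → Matrix κ ι ℝ} (hb : ∀ j, b j = -vecMulVec (g j) (xdot j))
    {a : J → Matrix κ κ ℝ} (ha : ∀ j, a j = vecMulVec (g j) (g j))
    {τ : J → ℝ} (hτ : ∀ j, 0 ≤ τ j)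
    {A : Matrix κ κ ℝ} (hA : A.PosDef) (B : Matrix κ ι ℝ)
    (hLMI : (-(fromBlocks (-1 - ∑ j, τ j • c j)
        (fromCols (Bᵀ - ∑ j, τ j • (b j)ᵀ) Bᵀ) (fromRows (B - ∑ j, τ j • b j) B)
        (fromBlocks (A - ∑ j, τ j • a j) 0 0 (-A)))).PosSemidef) (u : ι → ℝ) :
    (ζ + A⁻¹ * B) *ᵥ u ⬝ᵥ A *ᵥ (ζ + A⁻¹ * B) *ᵥ u ≤ u ⬝ᵥ u := by
  have hAunit : IsUnit A.det := (isUnit_iff_isUnit_det A).1 hA.isUnit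
  set y := ζ *ᵥ u with hy
  set v := A⁻¹ *ᵥ B *ᵥ u with hv
  have hAv : A *ᵥ v = B *ᵥ u := by
    rw [hv, mulVec_mulVec, mul_nonsing_inv _ hAunit, one_mulVec]
  have hform := hLMI.dotProduct_mulVec_nonneg (Sum.elim u (Sum.elim y v))
  rw [show Bᵀ - ∑ j, τ j • (b j)ᵀ = (B - ∑ j, τ j • b j)ᵀ by
    simp [transpose_sub, transpose_sum], star_trivial, neg_mulVec, dotProduct_neg,
    dotProduct_arrow_mulVec] at hform
  simp only [sub_mulVec, neg_mulVec, one_mulVec, dotProduct_sub, dotProduct_neg, sum_mulVec,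
    smul_mulVec, dotProduct_sum, dotProduct_smul, smul_eq_mul, hAv] at hform
  have hterm : ∀ j, τ j * (u ⬝ᵥ c j *ᵥ u) + 2 * (τ j * (y ⬝ᵥ b j *ᵥ u)) +
      τ j * (y ⬝ᵥ a j *ᵥ y) ≤ 0 := by
    intro j
    obtain ⟨d, hd, hdω⟩ := hdata j
    have hgy : xdot j ⬝ᵥ u = g j ⬝ᵥ y + d ⬝ᵥ u := by
      rw [hd, add_dotProduct, hy, mulVec_transpose, dotProduct_mulVec]
    have hdu := dotProduct_sq_le d u
    have huu : 0 ≤ u ⬝ᵥ u := by simpa using dotProduct_star_self_nonneg u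
    have hmul := mul_le_mul_of_nonneg_right hdω huu
    have hcj : u ⬝ᵥ c j *ᵥ u = -(ω * (u ⬝ᵥ u)) + (xdot j ⬝ᵥ u) ^ 2 := by
      simp [hc, add_mulVec, neg_mulVec, smul_mulVec, vecMulVec_mulVec, dotProduct_comm u (xdot j),
        sq]
    have hbj : y ⬝ᵥ b j *ᵥ u = -((g j ⬝ᵥ y) * (xdot j ⬝ᵥ u)) := by
      simp [hb, neg_mulVec, vecMulVec_mulVec, dotProduct_comm y (g j), mul_comm]
    have haj : y ⬝ᵥ a j *ᵥ y = (g j ⬝ᵥ y) ^ 2 := by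
      simp [ha, vecMulVec_mulVec, dotProduct_comm y (g j), sq]
    rw [hcj, hbj, haj, hgy]
    have : 0 ≤ τ j * (ω * (u ⬝ᵥ u) - (d ⬝ᵥ u) ^ 2) := mul_nonneg (hτ j) (by linarith)
    linarith
  have hsum := Finset.sum_nonpos fun j (_ : j ∈ Finset.univ) => hterm j
  simp only [Finset.sum_add_distrib, ← Finset.mul_sum] at hsum
  have hsymm : v ⬝ᵥ A *ᵥ y = y ⬝ᵥ B *ᵥ u := by
    have hAt : Aᵀ = A := by simpa using hA.isHermitian.eq
    rw [← hAv, dotProduct_mulVec, ← mulVec_transpose, hAt, dotProduct_comm]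
  rw [add_mulVec, ← mulVec_mulVec, ← hy, ← hv, mulVec_add, hAv]
  simp only [add_dotProduct, dotProduct_add, hsymm]
  linarith

/-- Robust dissipation: the matrix inequality `H ⪯ 0` bounds `∇h · ζᵀw` for every `ζ` in the
matrix ellipsoid centred at `ζbar`. -/
theorem dotProduct_le_of_ellipsoid {ι κ : Type*} [Fintype ι] [Fintype κ] [DecidableEq ι]
    [DecidableEq κ] {A P : Matrix κ κ ℝ} (hA : A.PosDef) (hP : P.PosDef) (hPA : P * P = A⁻¹)
    {ζ ζbar : Matrix κ ι ℝ} {γ : ι → ℝ} {w : κ → ℝ} {η r : ℝ} (hη : 0 < η)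
    (hell : (ζ - ζbar) *ᵥ γ ⬝ᵥ A *ᵥ (ζ - ζbar) *ᵥ γ ≤ γ ⬝ᵥ γ)
    (hH : (-(fromBlocks (of fun (_ _ : Fin 1) => r + γ ⬝ᵥ ζbarᵀ *ᵥ w)
      (fromCols (of fun (_ : Fin 1) j => η * (P *ᵥ w) j) (of fun (_ : Fin 1) j => γ j))
      (fromRows (of fun i (_ : Fin 1) => η * (P *ᵥ w) i) (of fun i (_ : Fin 1) => γ i))
      (fromBlocks ((-(2 * η)) • (1 : Matrix κ κ ℝ)) 0 0
        ((-(2 * η)) • (1 : Matrix ι ι ℝ))))).PosSemidef) :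
    r + γ ⬝ᵥ ζᵀ *ᵥ w ≤ 0 := by
  have hAunit : IsUnit A.det := (isUnit_iff_isUnit_det A).1 hA.isUnit
  have hPt : Pᵀ = P := by simpa using hP.isHermitian.eq
  have hform := hH.dotProduct_mulVec_nonneg
    (Sum.elim 1 (Sum.elim ((1 / 2 : ℝ) • P *ᵥ w) ((2 * η)⁻¹ • γ)))
  rw [show (of fun (_ : Fin 1) j => η * (P *ᵥ w) j) =
      (of fun i (_ : Fin 1) => η * (P *ᵥ w) i)ᵀ from rfl,
    show (of fun (_ : Fin 1) j => γ j) = (of fun i (_ : Fin 1) => γ i)ᵀ from rfl,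
    star_trivial, neg_mulVec, dotProduct_neg, dotProduct_arrow_mulVec] at hform
  have hcorner : (1 : Fin 1 → ℝ) ⬝ᵥ (of fun (_ _ : Fin 1) => r + γ ⬝ᵥ ζbarᵀ *ᵥ w) *ᵥ 1 =
      r + γ ⬝ᵥ ζbarᵀ *ᵥ w := by simp [dotProduct, mulVec]
  have hcolw : (of fun i (_ : Fin 1) => η * (P *ᵥ w) i) *ᵥ (1 : Fin 1 → ℝ) = η • P *ᵥ w := by
    ext; simp [mulVec, dotProduct]
  have hcolγ : (of fun i (_ : Fin 1) => γ i) *ᵥ (1 : Fin 1 → ℝ) = γ := by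
    ext; simp [mulVec, dotProduct]
  rw [hcorner, hcolw, hcolγ] at hform
  simp only [smul_mulVec, one_mulVec, dotProduct_smul, smul_dotProduct, smul_eq_mul] at hform
  set e := (ζ - ζbar) *ᵥ γ with he
  have hPmul : ∀ v₁ v₂ : κ → ℝ, P *ᵥ v₁ ⬝ᵥ P *ᵥ v₂ = v₁ ⬝ᵥ A⁻¹ *ᵥ v₂ := by
    intro v₁ v₂
    rw [← hPA, ← mulVec_mulVec, dotProduct_mulVec v₁, ← mulVec_transpose, hPt]
  have hinv : A⁻¹ *ᵥ A *ᵥ e = e := by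
    rw [mulVec_mulVec, nonsing_inv_mul _ hAunit, one_mulVec]
  have hyoung := two_mul_dotProduct_le hη (P *ᵥ w) (P *ᵥ A *ᵥ e)
  rw [hPmul w, hPmul (A *ᵥ e), hinv, dotProduct_comm (A *ᵥ e)] at hyoung
  have hwe : w ⬝ᵥ e = γ ⬝ᵥ ζᵀ *ᵥ w - γ ⬝ᵥ ζbarᵀ *ᵥ w := by
    rw [he, ← dotProduct_sub, ← sub_mulVec, ← transpose_sub, mulVec_transpose, dotProduct_comm γ,
      dotProduct_mulVec]
  have hscaled := mul_le_mul_of_nonneg_left hell (inv_nonneg.2 hη.le)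
  have hcancel : 2 * ((2 * η)⁻¹ * (γ ⬝ᵥ γ)) +
      -(2 * η) * ((2 * η)⁻¹ * ((2 * η)⁻¹ * (γ ⬝ᵥ γ))) = η⁻¹ * (γ ⬝ᵥ γ) / 2 := by
    field_simp
    ring
  nlinarith

/-- Evaluations of a sum-of-squares matrix polynomial are positive semidefinite. -/
theorem posSemidef_map_eval_sum {n k : ℕ} {ι : Type*} [Fintype ι]
    (M : Fin k → Matrix ι ι (MvPolynomial (Fin n) ℝ)) (x : Fin n → ℝ) :
    ((∑ i, (M i)ᵀ * M i).map (fun p => eval x p)).PosSemidef := by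
  have h : (∑ i, (M i)ᵀ * M i).map (fun p => eval x p) =
      ∑ i, ((M i).map (eval x))ᴴ * (M i).map (eval x) := by
    ext
    simp [Matrix.sum_apply, mul_apply]
  rw [h]
  exact posSemidef_sum _ fun i _ => posSemidef_conjTranspose_mul_self _

/-- A sublevel set is invariant along a curve on which the defining function has negative
derivative at its zeros. -/
theorem nonpos_of_deriv_neg_at_zeros {T : ℝ≥0∞} {f f' : ℝ → ℝ}
    (hf : ∀ t ∈ {r : ℝ | 0 ≤ r ∧ ENNReal.ofReal r < T},
      HasDerivWithinAt f (f' t) {r : ℝ | 0 ≤ r ∧ ENNReal.ofReal r < T} t)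
    (hneg : ∀ t, f t = 0 → f' t < 0) (h0 : f 0 ≤ 0) :
    ∀ t ∈ {r : ℝ | 0 ≤ r ∧ ENNReal.ofReal r < T}, f t ≤ 0 := by
  intro t ht
  have hsub : Set.Icc 0 t ⊆ {r : ℝ | 0 ≤ r ∧ ENNReal.ofReal r < T} := fun r hr =>
    ⟨hr.1, (ENNReal.ofReal_le_ofReal hr.2).trans_lt ht.2⟩
  refine image_le_of_deriv_right_lt_deriv_boundary (B := fun _ => 0) (B' := fun _ => 0)
    (fun r hr => ((hf r (hsub hr)).continuousWithinAt).mono hsub) (fun r hr => ?_) h0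
    (fun r => hasDerivAt_const r 0) (fun r _ hr => hneg r hr) ⟨ht.1, le_rfl⟩
  refine ((hf r (hsub ⟨hr.1, hr.2.le⟩)).mono hsub).mono_of_mem_nhdsWithin ?_
  exact Filter.mem_of_superset (Icc_mem_nhdsGE hr.2) (Set.Icc_subset_Icc_left hr.1)

/-- Data-driven safe control: under the data and LMI feasibility hypotheses, if the SOS
program (a)–(e) is feasible, then `I = {x : h(x) ≤ 0}` is invariant for the closed loop
`ẋ = A★Z(x) + B★W(x)K(x)` and `{λ ≤ θ} ⊆ I ⊆ {σⱼ ≤ 0 ∀j}`. -/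
theorem data_driven_safe_control
    (n m NA NB T q : ℕ) (ε ω : ℝ) (hε : 0 < ε) (hω : 0 ≤ ω)
    (Z : Fin NA → MvPolynomial (Fin n) ℝ)
    (W : Fin NB → Fin m → MvPolynomial (Fin n) ℝ)
    (Astar : Matrix (Fin n) (Fin NA) ℝ) (Bstar : Matrix (Fin n) (Fin NB) ℝ)
    (xdot : Fin T → Fin n → ℝ) (z : Fin T → Fin NA → ℝ) (v : Fin T → Fin NB → ℝ)
    (hdata : ∀ j, ∃ d : Fin n → ℝ,
      xdot j = Astar.mulVec (z j) + Bstar.mulVec (v j) + d ∧ ∑ i, d i ^ 2 ≤ ω)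
    (g : Fin T → (Fin NA ⊕ Fin NB) → ℝ) (hg : ∀ j, g j = Sum.elim (z j) (v j))
    (c : Fin T → Matrix (Fin n) (Fin n) ℝ)
    (hc : ∀ j, c j = -(ω • (1 : Matrix (Fin n) (Fin n) ℝ)) + vecMulVec (xdot j) (xdot j))
    (b : Fin T → Matrix (Fin NA ⊕ Fin NB) (Fin n) ℝ)
    (hb : ∀ j, b j = -vecMulVec (g j) (xdot j))
    (a : Fin T → Matrix (Fin NA ⊕ Fin NB) (Fin NA ⊕ Fin NB) ℝ)
    (ha : ∀ j, a j = vecMulVec (g j) (g j))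
    (τ : Fin T → ℝ) (hτ : ∀ j, 0 ≤ τ j)
    (Ai : Matrix (Fin NA ⊕ Fin NB) (Fin NA ⊕ Fin NB) ℝ) (hAi : Ai.PosDef)
    (Bi : Matrix (Fin NA ⊕ Fin NB) (Fin n) ℝ)
    (hLMI : (-(Matrix.fromBlocks
        (-(1 : Matrix (Fin n) (Fin n) ℝ) - ∑ j, τ j • c j)
        (Matrix.fromCols (Biᵀ - ∑ j, τ j • (b j)ᵀ) Biᵀ)
        (Matrix.fromRows (Bi - ∑ j, τ j • b j) Bi)
        (Matrix.fromBlocks (Ai - ∑ j, τ j • a j) 0 0 (-Ai)))).PosSemidef)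
    (ζbar : Matrix (Fin NA ⊕ Fin NB) (Fin n) ℝ) (hζbar : ζbar = -(Ai⁻¹ * Bi))
    (Pbar : Matrix (Fin NA ⊕ Fin NB) (Fin NA ⊕ Fin NB) ℝ)
    (hPbar : Pbar.PosDef) (hPbarsq : Pbar * Pbar = Ai⁻¹)
    (σ : Fin q → MvPolynomial (Fin n) ℝ) (lam : MvPolynomial (Fin n) ℝ)
    (ηbar : ℝ) (hηbar : 0 < ηbar) (θ : ℝ) (hθ : 0 ≤ θ)
    (ℓ η h : MvPolynomial (Fin n) ℝ) (K : Fin m → MvPolynomial (Fin n) ℝ)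
    (s : Fin q → MvPolynomial (Fin n) ℝ) (ς : MvPolynomial (Fin n) ℝ)
    (w : (Fin n → ℝ) → (Fin NA ⊕ Fin NB) → ℝ)
    (hw : ∀ x : Fin n → ℝ, w x = Sum.elim (fun i => eval x (Z i))
      (fun i => ∑ k, eval x (W i k) * eval x (K k)))
    (H : (Fin n → ℝ) →
      Matrix (Fin 1 ⊕ ((Fin NA ⊕ Fin NB) ⊕ Fin n)) (Fin 1 ⊕ ((Fin NA ⊕ Fin NB) ⊕ Fin n)) ℝ)
    (hH : ∀ x : Fin n → ℝ, H x = Matrix.fromBlocks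
      (Matrix.of fun (_ _ : Fin 1) =>
        eval x ℓ * eval x h + ε + gradPoly h x ⬝ᵥ ζbarᵀ.mulVec (w x))
      (Matrix.fromCols (Matrix.of fun (_ : Fin 1) j => eval x η * Pbar.mulVec (w x) j)
        (Matrix.of fun (_ : Fin 1) j => gradPoly h x j))
      (Matrix.fromRows (Matrix.of fun i (_ : Fin 1) => eval x η * Pbar.mulVec (w x) i)
        (Matrix.of fun i (_ : Fin 1) => gradPoly h x i))
      (Matrix.fromBlocks
        ((-(2 * eval x η)) • (1 : Matrix (Fin NA ⊕ Fin NB) (Fin NA ⊕ Fin NB) ℝ)) 0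
        0 ((-(2 * eval x η)) • (1 : Matrix (Fin n) (Fin n) ℝ))))
    -- condition (a): η − η̄ is SOS
    (hsosA : IsSOS (η - C ηbar))
    -- condition (b): −H is an SOS matrix polynomial
    (hsosB : ∃ (k : ℕ) (Hs : Fin k →
        Matrix (Fin 1 ⊕ ((Fin NA ⊕ Fin NB) ⊕ Fin n)) (Fin 1 ⊕ ((Fin NA ⊕ Fin NB) ⊕ Fin n))
          (MvPolynomial (Fin n) ℝ)),
      ∀ x : Fin n → ℝ, -(H x) = (∑ i, (Hs i)ᵀ * Hs i).map (fun p => eval x p))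
    -- condition (c): the multipliers are SOS
    (hsosC : (∀ j, IsSOS (s j)) ∧ IsSOS ς)
    -- condition (d): ς·(λ − θ) − h is SOS
    (hsosD : IsSOS (ς * (lam - C θ) - h))
    -- condition (e): sⱼ·h − σⱼ is SOS
    (hsosE : ∀ j, IsSOS (s j * h - σ j)) :
    -- conclusion: invariance of {x : h(x) ≤ 0} for the closed loop,
    (∀ (T' : ℝ≥0∞), 0 < T' → ∀ xc : ℝ → (Fin n → ℝ),
      (∀ t ∈ {sc : ℝ | 0 ≤ sc ∧ ENNReal.ofReal sc < T'},
        HasDerivWithinAt xc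
          (Astar.mulVec (fun i => eval (xc t) (Z i)) +
            Bstar.mulVec (fun i => ∑ k, eval (xc t) (W i k) * eval (xc t) (K k)))
          {sc : ℝ | 0 ≤ sc ∧ ENNReal.ofReal sc < T'} t) →
      eval (xc 0) h ≤ 0 →
      ∀ t ∈ {sc : ℝ | 0 ≤ sc ∧ ENNReal.ofReal sc < T'}, eval (xc t) h ≤ 0) ∧
    -- and the set inclusions {λ ≤ θ} ⊆ {h ≤ 0} ⊆ {σⱼ ≤ 0 ∀ j}
    ({x : Fin n → ℝ | eval x lam ≤ θ} ⊆ {x : Fin n → ℝ | eval x h ≤ 0}) ∧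
    ({x : Fin n → ℝ | eval x h ≤ 0} ⊆ {x : Fin n → ℝ | ∀ j, eval x (σ j) ≤ 0}) := by
  refine ⟨?_, fun x hx => ?_, fun x hx j => ?_⟩
  · set ζ : Matrix (Fin NA ⊕ Fin NB) (Fin n) ℝ := (fromCols Astar Bstar)ᵀ with hζ
    have hdata' : ∀ j, ∃ d : Fin n → ℝ, xdot j = ζᵀ *ᵥ g j + d ∧ d ⬝ᵥ d ≤ ω := fun j => by
      obtain ⟨d, hd, hdω⟩ := hdata j
      refine ⟨d, ?_, by simpa [dotProduct, sq] using hdω⟩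
      rw [hd, hg, hζ, transpose_transpose, fromCols_mulVec_sumElim]
    have hfield : ∀ x : Fin n → ℝ, Astar.mulVec (fun i => eval x (Z i)) +
        Bstar.mulVec (fun i => ∑ k, eval x (W i k) * eval x (K k)) = ζᵀ *ᵥ w x := fun x => by
      rw [hw, hζ, transpose_transpose, fromCols_mulVec_sumElim]
    have hdecr : ∀ x : Fin n → ℝ,
        eval x ℓ * eval x h + ε + gradPoly h x ⬝ᵥ ζᵀ *ᵥ w x ≤ 0 := fun x => by
      have hηx : 0 < eval x η := by
        have := hsosA.eval_nonneg x
        simp only [map_sub, eval_C] at this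
        linarith
      have hell := ellipsoid_of_LMI ζ xdot g hdata' hc hb ha hτ hAi Bi hLMI (gradPoly h x)
      rw [show ζ + Ai⁻¹ * Bi = ζ - ζbar by rw [hζbar, sub_neg_eq_add]] at hell
      obtain ⟨k, Hs, hHs⟩ := hsosB
      have hpsd := posSemidef_map_eval_sum Hs x
      rw [← hHs, hH] at hpsd
      exact dotProduct_le_of_ellipsoid hAi hPbar hPbarsq hηx hell hpsd
    intro T' _ xc hxc h0
    refine nonpos_of_deriv_neg_at_zeros (f := fun t => eval (xc t) h)
      (fun t ht => hasDerivWithinAt_eval_comp h (hxc t ht)) (fun t ht => ?_) h0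
    have := hdecr (xc t)
    rw [hfield]
    simp only [ht, mul_zero] at this
    linarith
  · have hD := hsosD.eval_nonneg x
    simp only [map_sub, map_mul, eval_C] at hD
    have := mul_nonpos_of_nonneg_of_nonpos (hsosC.2.eval_nonneg x) (sub_nonpos.2 hx)
    exact le_trans (sub_nonneg.1 hD) this
  · have hE := (hsosE j).eval_nonneg x
    simp only [map_sub, map_mul] at hE
    exact (sub_nonneg.1 hE).trans
      (mul_nonpos_of_nonneg_of_nonpos ((hsosC.1 j).eval_nonneg x) hx)
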